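/- arXiv:1609.01870 — 6 statements merged into one kernel-verified Lean document; each statement's English description precedes it below -/
import Mathlib

section
/- Let (G_n)_{n≥0} be a sequence of real polynomials satisfying G_0 = 1 and, for every n ≥ 1, G_n(z) = (z^{n+1}/n) · Σ_{j=1}^{n} G_{n-j}(z) · G_{j-1}(z). Then for every n ≥ 1, G_n'(1) = 2((n+1)·H_n − n), where H_n = Σ_{k=1}^{n} 1/k. -/
open Polynomial Finset

theorem sum_range_quicksort_mean (n : ℕ) :
    ∑ i ∈ range n, 2 * (((i : ℝ) + 1) * (∑ k ∈ Icc 1 i, (1 : ℝ) / k) - i) =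
      n * (n + 1) * (∑ k ∈ Icc 1 n, (1 : ℝ) / k) - n ^ 2 - n * (n + 1) / 2 := by
  induction n with
  | zero => simp
  | succ n ih =>
    rw [sum_range_succ, ih, sum_Icc_succ_top (by omega : 1 ≤ n + 1)]
    push_cast
    field_simp
    ring

theorem sum_Icc_one_succ_mul_reflect {R : Type*} [Semiring R] (f : ℕ → R) (n : ℕ) :
    ∑ j ∈ Icc 1 (n + 1), f (n + 1 - j) * f (j - 1) =
      ∑ i ∈ range (n + 1), f (n - i) * f i := by
  rw [← Ico_add_one_right_eq_Icc, sum_Ico_eq_sum_range]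
  refine sum_congr (by simp) fun i _ => ?_
  congr 2 <;> omega

/-- Stated for the index `n + 1`, so that no natural-number predecessor appears. -/
theorem eval_one_quicksort_pgf (G : ℕ → Polynomial ℝ) (hG0 : G 0 = 1)
    (hGrec : ∀ n : ℕ, G (n + 1) = C ((n + 1 : ℕ) : ℝ)⁻¹ * X ^ (n + 2) *
      ∑ i ∈ range (n + 1), G (n - i) * G i) (n : ℕ) :
    (G n).eval 1 = 1 := by
  induction n using Nat.strong_induction_on with
  | _ n ih =>
    cases n with
    | zero => simp [hG0]
    | succ n =>
      have hsum : ∑ i ∈ range (n + 1), (G (n - i)).eval 1 * (G i).eval 1 = (n + 1 : ℝ) := by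
        rw [sum_congr rfl (g := fun _ => (1 : ℝ)) fun i hi => ?_]
        · simp
        · rw [ih _ (by omega), ih i (by simpa using hi), one_mul]
      rw [hGrec]
      simp only [eval_mul, eval_C, eval_pow, eval_X, one_pow, eval_finsetSum, hsum]
      push_cast
      field_simp

theorem eval_one_derivative_quicksort_pgf (G : ℕ → Polynomial ℝ) (hG0 : G 0 = 1)
    (hGrec : ∀ n : ℕ, G (n + 1) = C ((n + 1 : ℕ) : ℝ)⁻¹ * X ^ (n + 2) *
      ∑ i ∈ range (n + 1), G (n - i) * G i) (n : ℕ) :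
    (derivative (G (n + 1))).eval 1 =
      n + 2 + 2 / (n + 1) * ∑ i ∈ range (n + 1), (derivative (G i)).eval 1 := by
  have h1 := eval_one_quicksort_pgf G hG0 hGrec
  have hrefl : ∑ i ∈ range (n + 1), (derivative (G (n - i))).eval 1 =
      ∑ i ∈ range (n + 1), (derivative (G i)).eval 1 := by
    simpa using sum_range_reflect (fun i => (derivative (G i)).eval 1) (n + 1)
  rw [hGrec]
  simp only [derivative_mul, derivative_C, derivative_X_pow, derivative_sum, eval_add, eval_mul,
    eval_C, eval_pow, eval_X, one_pow, eval_finsetSum, h1, sum_add_distrib, mul_one, one_mul,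
    hrefl, zero_mul, zero_add, sum_const, card_range, nsmul_eq_mul]
  push_cast
  field_simp
  ring

theorem quicksort_mean_closed_form
    (G : ℕ → Polynomial ℝ)
    (hG0 : G 0 = 1)
    (hGrec : ∀ n : ℕ, 1 ≤ n →
      G n = Polynomial.C ((n : ℝ))⁻¹ * Polynomial.X ^ (n + 1) *
        ∑ j ∈ Finset.Icc 1 n, G (n - j) * G (j - 1)) :
    ∀ n : ℕ, 1 ≤ n →
      (Polynomial.derivative (G n)).eval 1 =
        2 * ((n + 1) * (∑ k ∈ Finset.Icc 1 n, (1 : ℝ) / k) - n) := by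
  have hrec : ∀ n : ℕ, G (n + 1) = C ((n + 1 : ℕ) : ℝ)⁻¹ * X ^ (n + 2) *
      ∑ i ∈ range (n + 1), G (n - i) * G i := fun n => by
    rw [hGrec (n + 1) (by omega), sum_Icc_one_succ_mul_reflect]
  intro n _
  induction n using Nat.strong_induction_on with
  | _ n ih =>
    cases n with
    | zero => simp [hG0]
    | succ n =>
      have hsum : ∀ i ∈ range (n + 1), (derivative (G i)).eval 1 =
          2 * (((i : ℝ) + 1) * (∑ k ∈ Icc 1 i, (1 : ℝ) / k) - i) := fun i hi => by
        rcases Nat.eq_zero_or_pos i with rfl | hpos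
        · simp [hG0]
        · exact ih i (by simpa using hi) hpos
      rw [eval_one_derivative_quicksort_pgf G hG0 hrec, sum_congr rfl hsum,
        sum_range_quicksort_mean]
      push_cast
      field_simp
      ring
end

section
/- Let (G_n)_{n≥0} be a sequence of real polynomials satisfying G_0 = 1 and, for every n ≥ 1, G_n(z) = (z^{n+1}/n) · Σ_{j=1}^{n} G_{n-j}(z) · G_{j-1}(z). Then for every n ≥ 1, G_n''(1) = 4(n+1)^2 (H_n^2 − H_n^{(2)}) + 4(n+1)^2 H_n − 8(n+1) H_n + 8 n H_n − 4 n H_n (5 + 3n) + 11 n^2 + 15 n, where H_n = Σ_{k=1}^{n} 1/k and H_n^{(2)} = Σ_{k=1}^{n} 1/k^2. -/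
open Polynomial Finset

/-- Sums over `Icc 1 n` as sums over the antidiagonal in the quicksort recurrence. -/
theorem sum_Icc_eq_sum_antidiagonal {R : Type*} [CommSemiring R] (f : ℕ → R) (n : ℕ) :
    ∑ j ∈ Finset.Icc 1 (n + 1), f (n + 1 - j) * f (j - 1) =
      ∑ p ∈ HasAntidiagonal.antidiagonal n, f p.1 * f p.2 := by
  rw [← Finset.Nat.sum_antidiagonal_swap, Finset.Nat.sum_antidiagonal_eq_sum_range_succ_mk,
    Finset.range_eq_Ico, ← Finset.Ico_add_one_right_eq_Icc,
    Finset.sum_Ico_eq_sum_range, Finset.sum_Ico_eq_sum_range]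
  refine Finset.sum_congr (by simp) fun k _ => ?_
  simp only [Prod.swap, Nat.zero_add]
  congr 2 <;> omega

theorem sum_antidiagonal_snd_succ (f : ℕ → ℝ) (n : ℕ) :
    ∑ p ∈ HasAntidiagonal.antidiagonal (n + 1), f p.2 =
      f (n + 1) + ∑ p ∈ HasAntidiagonal.antidiagonal n, f p.2 :=
  Finset.Nat.sum_antidiagonal_succ

theorem sum_antidiagonal_fst_eq_snd (f : ℕ → ℝ) (n : ℕ) :
    ∑ p ∈ HasAntidiagonal.antidiagonal n, f p.1 = ∑ p ∈ HasAntidiagonal.antidiagonal n, f p.2 :=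
  (Finset.Nat.sum_antidiagonal_swap (n := n) (f := fun p => f p.1)).symm

/-- The mean of the quicksort recurrence and its partial sums. -/
theorem quicksort_mean_closed_form_s5 {M h : ℕ → ℝ} (hM0 : M 0 = 0) (hh0 : h 0 = 0)
    (hh : ∀ n : ℕ, h (n + 1) = h n + 1 / (n + 1))
    (hM : ∀ n : ℕ, ((n : ℝ) + 1) * M (n + 1) =
      (n + 1) * (n + 2) + 2 * ∑ p ∈ HasAntidiagonal.antidiagonal n, M p.2) (n : ℕ) :
    M n = 2 * (n + 1) * h n - 2 * n ∧
      ∑ p ∈ HasAntidiagonal.antidiagonal n, M p.2 =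
        (n + 1) * (n + 2) * h n + (n + 1) + (n + 2) - 3 / 2 * (n + 1) * (n + 2) := by
  induction n with
  | zero => norm_num [hM0, hh0]
  | succ n ih =>
    have hn : (n : ℝ) + 1 ≠ 0 := by positivity
    have e : M (n + 1) = 2 * (n + 2) * h (n + 1) - 2 * (n + 1) := by
      apply mul_left_cancel₀ hn
      rw [hM, ih.2, hh]
      field_simp
      ring
    refine ⟨by rw [e]; push_cast; ring, ?_⟩
    rw [sum_antidiagonal_snd_succ, e, ih.2, hh]
    push_cast
    field_simp
    ring

theorem sum_weighted_mean_closed_form {M h : ℕ → ℝ} (hM0 : M 0 = 0) (hh0 : h 0 = 0)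
    (hh : ∀ n : ℕ, h (n + 1) = h n + 1 / (n + 1))
    (hM : ∀ n : ℕ, ((n : ℝ) + 1) * M (n + 1) =
      (n + 1) * (n + 2) + 2 * ∑ p ∈ HasAntidiagonal.antidiagonal n, M p.2) (n : ℕ) :
    ∑ p ∈ HasAntidiagonal.antidiagonal n, ((p.1 : ℝ) + 1) * M p.2 =
      (n + 1) * (n + 2) * (n + 3) / 3 *
        (h n + 1 / (n + 1) + 1 / (n + 2) + 1 / (n + 3) - 11 / 6) := by
  induction n with
  | zero => norm_num [hM0, hh0]
  | succ n ih =>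
    have key : ∑ p ∈ HasAntidiagonal.antidiagonal (n + 1), ((p.1 : ℝ) + 1) * M p.2 =
        M (n + 1) + (∑ p ∈ HasAntidiagonal.antidiagonal n, ((p.1 : ℝ) + 1) * M p.2 +
          ∑ p ∈ HasAntidiagonal.antidiagonal n, M p.2) := by
      rw [Finset.Nat.sum_antidiagonal_succ, ← Finset.sum_add_distrib]
      congr 1
      · simp
      · refine Finset.sum_congr rfl fun p _ => ?_
        push_cast
        ring
    rw [key, ih, (quicksort_mean_closed_form_s5 hM0 hh0 hh hM n).2,
      (quicksort_mean_closed_form_s5 hM0 hh0 hh hM (n + 1)).1, hh]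
    push_cast
    field_simp
    ring

/-- A first-order recurrence for the self-convolution of the means. -/
theorem convolution_mean_succ {M h : ℕ → ℝ} (hM0 : M 0 = 0) (hh0 : h 0 = 0)
    (hh : ∀ n : ℕ, h (n + 1) = h n + 1 / (n + 1))
    (hM : ∀ n : ℕ, ((n : ℝ) + 1) * M (n + 1) =
      (n + 1) * (n + 2) + 2 * ∑ p ∈ HasAntidiagonal.antidiagonal n, M p.2) (n : ℕ) :
    ((n : ℝ) + 1) * ∑ p ∈ HasAntidiagonal.antidiagonal (n + 1), M p.1 * M p.2 =
      (n + 4) * ∑ p ∈ HasAntidiagonal.antidiagonal n, M p.1 * M p.2 +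
        4 * ∑ p ∈ HasAntidiagonal.antidiagonal n, ((p.1 : ℝ) + 1) * M p.2 := by
  have step (i : ℕ) : ((i : ℝ) + 1) * M (i + 1) = (i + 2) * M i + 2 * (i + 1) := by
    rw [(quicksort_mean_closed_form_s5 hM0 hh0 hh hM i).1,
      (quicksort_mean_closed_form_s5 hM0 hh0 hh hM (i + 1)).1, hh]
    push_cast
    field_simp
    ring
  have weight (m : ℕ) : (m : ℝ) * ∑ p ∈ HasAntidiagonal.antidiagonal m, M p.1 * M p.2 =
      2 * ∑ p ∈ HasAntidiagonal.antidiagonal m, (p.1 : ℝ) * (M p.1 * M p.2) := by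
    have hswap : ∑ p ∈ HasAntidiagonal.antidiagonal m, (p.1 : ℝ) * (M p.1 * M p.2) =
        ∑ p ∈ HasAntidiagonal.antidiagonal m, (p.2 : ℝ) * (M p.1 * M p.2) := by
      rw [← Finset.Nat.sum_antidiagonal_swap]
      refine Finset.sum_congr rfl fun p _ => ?_
      simp only [Prod.fst_swap, Prod.snd_swap]
      ring
    rw [two_mul]
    nth_rewrite 2 [hswap]
    rw [← Finset.sum_add_distrib, Finset.mul_sum]
    refine Finset.sum_congr rfl fun p hp => ?_
    rw [← HasAntidiagonal.mem_antidiagonal.mp hp]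
    push_cast
    ring
  have hw := weight (n + 1)
  push_cast at hw
  have expand : ∑ p ∈ HasAntidiagonal.antidiagonal n, ((p.1 + 1 : ℕ) : ℝ) * (M (p.1 + 1) * M p.2) =
      ∑ p ∈ HasAntidiagonal.antidiagonal n, (p.1 : ℝ) * (M p.1 * M p.2) +
        2 * ∑ p ∈ HasAntidiagonal.antidiagonal n, M p.1 * M p.2 +
        2 * ∑ p ∈ HasAntidiagonal.antidiagonal n, ((p.1 : ℝ) + 1) * M p.2 := by
    rw [Finset.mul_sum, Finset.mul_sum, ← Finset.sum_add_distrib, ← Finset.sum_add_distrib]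
    refine Finset.sum_congr rfl fun p _ => ?_
    push_cast
    linear_combination M p.2 * step p.1
  rw [hw, Finset.Nat.sum_antidiagonal_succ, expand]
  simp only [hM0, zero_mul, mul_zero, zero_add]
  linear_combination -weight n

theorem convolution_mean_closed_form {M h s : ℕ → ℝ} (hM0 : M 0 = 0) (hh0 : h 0 = 0)
    (hs0 : s 0 = 0) (hh : ∀ n : ℕ, h (n + 1) = h n + 1 / (n + 1))
    (hs : ∀ n : ℕ, s (n + 1) = s n + 1 / ((n : ℝ) + 1) ^ 2)
    (hM : ∀ n : ℕ, ((n : ℝ) + 1) * M (n + 1) =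
      (n + 1) * (n + 2) + 2 * ∑ p ∈ HasAntidiagonal.antidiagonal n, M p.2) (n : ℕ) :
    ∑ p ∈ HasAntidiagonal.antidiagonal n, M p.1 * M p.2 =
      2 * ((n + 1) * (n + 2) * (n + 3)) / 3 *
        ((h n + 1 / (n + 1) + 1 / (n + 2) + 1 / (n + 3) - 11 / 6) ^ 2 -
          (s n + 1 / (n + 1) ^ 2 + 1 / (n + 2) ^ 2 + 1 / (n + 3) ^ 2 - 49 / 36)) := by
  induction n with
  | zero => norm_num [hM0, hh0, hs0]
  | succ n ih =>
    have hn : (n : ℝ) + 1 ≠ 0 := by positivity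
    apply mul_left_cancel₀ hn
    rw [convolution_mean_succ hM0 hh0 hh hM, ih,
      sum_weighted_mean_closed_form hM0 hh0 hh hM, hh, hs]
    push_cast
    field_simp
    ring

/-- The solution of the recurrence for the second factorial moments. -/
theorem second_factorial_moment_closed_form {M b h s : ℕ → ℝ} (hM0 : M 0 = 0) (hb0 : b 0 = 0)
    (hh0 : h 0 = 0) (hs0 : s 0 = 0) (hh : ∀ n : ℕ, h (n + 1) = h n + 1 / (n + 1))
    (hs : ∀ n : ℕ, s (n + 1) = s n + 1 / ((n : ℝ) + 1) ^ 2)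
    (hM : ∀ n : ℕ, ((n : ℝ) + 1) * M (n + 1) =
      (n + 1) * (n + 2) + 2 * ∑ p ∈ HasAntidiagonal.antidiagonal n, M p.2)
    (hb : ∀ n : ℕ, ((n : ℝ) + 1) * b (n + 1) =
      (n + 1) * (n + 1) * (n + 2) + 4 * (n + 2) * ∑ p ∈ HasAntidiagonal.antidiagonal n, M p.2 +
        2 * ∑ p ∈ HasAntidiagonal.antidiagonal n, M p.1 * M p.2 +
        2 * ∑ p ∈ HasAntidiagonal.antidiagonal n, b p.2) (n : ℕ) :
    b n = 4 * (n + 1) ^ 2 * (h n ^ 2 - s n) + 4 * (n + 1) ^ 2 * h n - 8 * (n + 1) * h n +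
      8 * n * h n - 4 * n * h n * (5 + 3 * n) + 11 * n ^ 2 + 15 * n := by
  have hn (n : ℕ) : (n : ℝ) + 1 ≠ 0 := by positivity
  induction n with
  | zero => norm_num [hb0, hh0, hs0]
  | succ n ih =>
    have hS := fun m => (quicksort_mean_closed_form_s5 hM0 hh0 hh hM m).2
    have hC := convolution_mean_closed_form hM0 hh0 hs0 hh hs hM
    apply mul_left_cancel₀ (hn n)
    rcases n with _ | n
    · rw [hb, hh, hs]
      norm_num [hb0, hM0, hh0, hs0]
    · have e := hb n
      rw [hS, hC, ih, hh, hs] at e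
      have e' := hb (n + 1)
      rw [hS, hC, sum_antidiagonal_snd_succ b, ih] at e'
      rw [hh (n + 1), hs (n + 1)]
      rw [hh, hs] at e' ⊢
      push_cast at e e' ⊢
      rw [e']
      linear_combination (norm := (field_simp; ring)) -e

theorem quicksort_second_factorial_moment_closed_form
    (G : ℕ → Polynomial ℝ)
    (hG0 : G 0 = 1)
    (hGrec : ∀ n : ℕ, 1 ≤ n →
      G n = Polynomial.C ((n : ℝ))⁻¹ * Polynomial.X ^ (n + 1) *
        ∑ j ∈ Finset.Icc 1 n, G (n - j) * G (j - 1)) :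
    ∀ n : ℕ, 1 ≤ n →
      (Polynomial.derivative (Polynomial.derivative (G n))).eval 1 =
        4 * (n + 1) ^ 2 * ((∑ k ∈ Finset.Icc 1 n, (1 : ℝ) / k) ^ 2
            - (∑ k ∈ Finset.Icc 1 n, (1 : ℝ) / (k : ℝ) ^ 2))
        + 4 * (n + 1) ^ 2 * (∑ k ∈ Finset.Icc 1 n, (1 : ℝ) / k)
        - 8 * (n + 1) * (∑ k ∈ Finset.Icc 1 n, (1 : ℝ) / k)
        + 8 * n * (∑ k ∈ Finset.Icc 1 n, (1 : ℝ) / k)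
        - 4 * n * (∑ k ∈ Finset.Icc 1 n, (1 : ℝ) / k) * (5 + 3 * n)
        + 11 * n ^ 2 + 15 * n := by
  have hG (n : ℕ) : Polynomial.C ((n : ℝ) + 1) * G (n + 1) =
      X ^ (n + 2) * ∑ p ∈ HasAntidiagonal.antidiagonal n, G p.1 * G p.2 := by
    rw [hGrec (n + 1) (by omega), sum_Icc_eq_sum_antidiagonal, ← mul_assoc, ← mul_assoc,
      ← Polynomial.C_mul]
    push_cast
    rw [mul_inv_cancel₀ (by positivity)]
    simp
  have one (n : ℕ) : (G n).eval 1 = 1 := by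
    induction n using Nat.strong_induction_on with
    | _ n ih =>
      rcases n with _ | n
      · simp [hG0]
      · have hn : (n : ℝ) + 1 ≠ 0 := by positivity
        have e := congrArg (Polynomial.eval 1) (hG n)
        simp only [eval_mul, eval_C, eval_pow, eval_X, one_pow, one_mul, eval_finsetSum] at e
        rw [Finset.sum_congr rfl (g := fun _ => (1 : ℝ)) fun p hp => ?_] at e
        · apply mul_left_cancel₀ hn
          simpa using e
        · have := HasAntidiagonal.mem_antidiagonal.mp hp
          rw [ih _ (by omega), ih _ (by omega), one_mul]
  have mean (n : ℕ) : ((n : ℝ) + 1) * (derivative (G (n + 1))).eval 1 = (n + 1) * (n + 2) +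
      2 * ∑ p ∈ HasAntidiagonal.antidiagonal n, (derivative (G p.2)).eval 1 := by
    have e := congrArg (fun P => (derivative P).eval 1) (hG n)
    simp [derivative_mul, eval_finsetSum, one, Finset.sum_add_distrib,
      sum_antidiagonal_fst_eq_snd fun k => (derivative (G k)).eval 1] at e
    linear_combination e
  have second (n : ℕ) : ((n : ℝ) + 1) * (derivative (derivative (G (n + 1)))).eval 1 =
      (n + 1) * (n + 1) * (n + 2) +
        4 * (n + 2) * ∑ p ∈ HasAntidiagonal.antidiagonal n, (derivative (G p.2)).eval 1 +
        2 * ∑ p ∈ HasAntidiagonal.antidiagonal n,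
          (derivative (G p.1)).eval 1 * (derivative (G p.2)).eval 1 +
        2 * ∑ p ∈ HasAntidiagonal.antidiagonal n, (derivative (derivative (G p.2))).eval 1 := by
    have e := congrArg (fun P => (derivative (derivative P)).eval 1) (hG n)
    simp [derivative_mul, eval_finsetSum, one, Finset.sum_add_distrib,
      sum_antidiagonal_fst_eq_snd fun k => (derivative (G k)).eval 1,
      sum_antidiagonal_fst_eq_snd fun k => (derivative (derivative (G k))).eval 1] at e
    linear_combination e
  intro n _
  exact second_factorial_moment_closed_form
    (M := fun n => (derivative (G n)).eval 1)
    (b := fun n => (derivative (derivative (G n))).eval 1)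
    (h := fun n => ∑ k ∈ Finset.Icc 1 n, (1 : ℝ) / k)
    (s := fun n => ∑ k ∈ Finset.Icc 1 n, (1 : ℝ) / (k : ℝ) ^ 2)
    (by simp [hG0]) (by simp [hG0]) (by simp) (by simp)
    (fun n => by simp [Finset.sum_Icc_succ_top])
    (fun n => by simp [Finset.sum_Icc_succ_top])
    mean second n
end

section
/- Let (G_n)_{n≥0} be a sequence of real polynomials satisfying G_0 = 1 and, for every n ≥ 1, G_n(z) = (z^{n+1}/n) · Σ_{j=1}^{n} G_{n-j}(z) · G_{j-1}(z). Then for every n ≥ 1, G_n''(1) − (G_n'(1))^2 + G_n'(1) = 7n^2 − 4(n+1)^2 H_n^{(2)} − 2(n+1) H_n + 13 n, where H_n = Σ_{k=1}^{n} 1/k and H_n^{(2)} = Σ_{k=1}^{n} 1/k^2. -/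
open Polynomial Finset

/-- The harmonic sum `∑ 1 / k ^ r` over `1 ≤ k ≤ n`, as a real number. -/
noncomputable def harmonicSum (r n : ℕ) : ℝ := ∑ k ∈ Finset.Icc 1 n, (1 : ℝ) / (k : ℝ) ^ r

lemma harmonicSum_zero (r : ℕ) : harmonicSum r 0 = 0 := by simp [harmonicSum]

lemma harmonicSum_succ (r n : ℕ) :
    harmonicSum r (n + 1) = harmonicSum r n + 1 / ((n : ℝ) + 1) ^ r := by
  simp [harmonicSum, Finset.sum_Icc_succ_top]

/-- The mean number of comparisons, in closed form. -/
noncomputable def quicksortMean (n : ℕ) : ℝ := 2 * (n + 1) * harmonicSum 1 n - 2 * n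

lemma quicksortMean_zero : quicksortMean 0 = 0 := by
  simp [quicksortMean, harmonicSum_zero]

lemma quicksortMean_succ (n : ℕ) :
    ((n : ℝ) + 1) * quicksortMean (n + 1) = (n + 2) * quicksortMean n + 2 * (n + 1) := by
  have h : (n : ℝ) + 1 ≠ 0 := by positivity
  simp only [quicksortMean, harmonicSum_succ]
  push_cast
  field_simp
  ring

lemma sum_antidiagonal_fst (f : ℕ → ℝ) (n : ℕ) :
    ∑ p ∈ antidiagonal n, f p.1 = ∑ i ∈ range (n + 1), f i :=
  Finset.Nat.sum_antidiagonal_eq_sum_range_succ_mk (fun p => f p.1) n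

lemma sum_antidiagonal_snd (f : ℕ → ℝ) (n : ℕ) :
    ∑ p ∈ antidiagonal n, f p.2 = ∑ i ∈ range (n + 1), f i := by
  rw [← sum_antidiagonal_fst, ← Finset.Nat.sum_antidiagonal_swap]
  rfl

lemma sum_quicksortMean (n : ℕ) :
    2 * ∑ i ∈ range (n + 1), quicksortMean i =
      (n + 1) * quicksortMean (n + 1) - (n + 1) * (n + 2) := by
  induction n with
  | zero => norm_num [quicksortMean, harmonicSum]
  | succ n ih =>
    have h := quicksortMean_succ (n + 1)
    rw [Finset.sum_range_succ, mul_add, ih]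
    push_cast at h ⊢
    linear_combination -h

lemma sum_succ_mul_quicksortMean (n : ℕ) :
    ∑ p ∈ antidiagonal n, ((p.1 : ℝ) + 1) * quicksortMean p.2 =
      (n + 1) * (n + 2) * (n + 3) / 3 * harmonicSum 1 n
        - (11 * n ^ 3 + 48 * n ^ 2 + 49 * n) / 18 := by
  induction n with
  | zero => simp [quicksortMean_zero, harmonicSum_zero]
  | succ n ih =>
    have hsplit : ∑ p ∈ antidiagonal n, (((p.1 + 1 : ℕ) : ℝ) + 1) * quicksortMean p.2 =
        ∑ p ∈ antidiagonal n, ((p.1 : ℝ) + 1) * quicksortMean p.2 +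
          ∑ i ∈ range (n + 1), quicksortMean i := by
      rw [← sum_antidiagonal_snd, ← Finset.sum_add_distrib]
      refine Finset.sum_congr rfl fun p _ => ?_
      push_cast
      ring
    have hsum := sum_quicksortMean n
    have h : (n : ℝ) + 1 ≠ 0 := by positivity
    rw [Finset.Nat.sum_antidiagonal_succ]
    dsimp only
    rw [hsplit, ih, eq_div_of_mul_eq two_ne_zero ((mul_comm _ _).trans hsum)]
    simp only [quicksortMean, harmonicSum_succ]
    push_cast
    field_simp
    ring

/-- The self-convolution of `quicksortMean`. -/
noncomputable def meanConvolution (n : ℕ) : ℝ :=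
  ∑ p ∈ antidiagonal n, quicksortMean p.1 * quicksortMean p.2

lemma meanConvolution_succ (n : ℕ) :
    ((n : ℝ) + 1) * meanConvolution (n + 1) = (n + 4) * meanConvolution n +
      4 * ∑ p ∈ antidiagonal n, ((p.1 : ℝ) + 1) * quicksortMean p.2 := by
  have weighted (m : ℕ) : (m : ℝ) * meanConvolution m =
      2 * ∑ p ∈ antidiagonal m, (p.1 : ℝ) * quicksortMean p.1 * quicksortMean p.2 := by
    have hswap : ∑ p ∈ antidiagonal m, (p.1 : ℝ) * quicksortMean p.1 * quicksortMean p.2 =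
        ∑ p ∈ antidiagonal m, (p.2 : ℝ) * quicksortMean p.1 * quicksortMean p.2 := by
      rw [← Finset.Nat.sum_antidiagonal_swap]
      refine Finset.sum_congr rfl fun p _ => ?_
      simp only [Prod.fst_swap, Prod.snd_swap]
      ring
    rw [two_mul]
    nth_rewrite 2 [hswap]
    rw [← Finset.sum_add_distrib, meanConvolution, Finset.mul_sum]
    refine Finset.sum_congr rfl fun p hp => ?_
    rw [← mem_antidiagonal.mp hp]
    push_cast
    ring
  have hsucc := weighted (n + 1)
  rw [Finset.Nat.sum_antidiagonal_succ] at hsucc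
  have hstep : ∑ p ∈ antidiagonal n,
      ((p.1 + 1 : ℕ) : ℝ) * quicksortMean (p.1 + 1) * quicksortMean p.2 =
      ∑ p ∈ antidiagonal n, (p.1 : ℝ) * quicksortMean p.1 * quicksortMean p.2 +
        2 * meanConvolution n +
        2 * ∑ p ∈ antidiagonal n, ((p.1 : ℝ) + 1) * quicksortMean p.2 := by
    rw [meanConvolution, Finset.mul_sum, Finset.mul_sum, ← Finset.sum_add_distrib,
      ← Finset.sum_add_distrib]
    refine Finset.sum_congr rfl fun p _ => ?_
    push_cast
    rw [quicksortMean_succ]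
    ring
  dsimp only at hsucc
  rw [hstep] at hsucc
  push_cast at hsucc
  linear_combination hsucc - weighted n

lemma meanConvolution_eq (n : ℕ) :
    meanConvolution n =
      2 / 3 * (n + 1) * (n + 2) * (n + 3) * (harmonicSum 1 n ^ 2 - harmonicSum 2 n)
        - (22 * n ^ 3 + 96 * n ^ 2 + 98 * n) / 9 * harmonicSum 1 n
        + (85 * n ^ 3 + 312 * n ^ 2 + 251 * n) / 27 := by
  induction n with
  | zero => simp [meanConvolution, quicksortMean_zero, harmonicSum_zero]
  | succ n ih =>
    have h : (n : ℝ) + 1 ≠ 0 := by positivity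
    have hrec := meanConvolution_succ n
    rw [ih, sum_succ_mul_quicksortMean] at hrec
    apply mul_left_cancel₀ h
    rw [hrec]
    simp only [harmonicSum_succ]
    push_cast
    field_simp
    ring

/-- A solution of the quicksort recurrence with toll `r` is determined by its value at `0`. -/
lemma eq_of_quicksort_recurrence {a b r : ℕ → ℝ}
    (ha : ∀ n : ℕ, ((n : ℝ) + 1) * a (n + 1) = r n + 2 * ∑ i ∈ range (n + 1), a i)
    (h0 : a 0 = b 0) (h1 : b 1 = r 0 + 2 * b 0)
    (hb : ∀ n : ℕ, ((n : ℝ) + 2) * b (n + 2) = (n + 3) * b (n + 1) + r (n + 1) - r n) (n : ℕ) :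
    a n = b n := by
  induction n with
  | zero => exact h0
  | succ n ih =>
    cases n with
    | zero =>
      have h := ha 0
      simp only [zero_add, Finset.sum_range_one, h0] at h
      rw [zero_add, h1, ← h]
      simp
    | succ n =>
      have hnext := ha (n + 1)
      rw [Finset.sum_range_succ] at hnext
      have hcur := ha n
      have h : (n : ℝ) + 2 ≠ 0 := by positivity
      apply mul_left_cancel₀ h
      rw [hb n, ← ih]
      push_cast at hnext
      linear_combination hnext - hcur

/-- The second factorial moment of the number of comparisons, in closed form. -/
noncomputable def quicksortSecondMoment (n : ℕ) : ℝ :=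
  7 * n ^ 2 - 4 * (n + 1) ^ 2 * harmonicSum 2 n - 2 * (n + 1) * harmonicSum 1 n + 13 * n
    + quicksortMean n ^ 2 - quicksortMean n

section GeneratingFunction

variable {G : ℕ → Polynomial ℝ}

lemma generating_succ
    (hGrec : ∀ n : ℕ, 1 ≤ n →
      G n = Polynomial.C ((n : ℝ))⁻¹ * Polynomial.X ^ (n + 1) *
        ∑ j ∈ Finset.Icc 1 n, G (n - j) * G (j - 1)) (n : ℕ) :
    Polynomial.C ((n : ℝ) + 1) * G (n + 1) =
      Polynomial.X ^ (n + 2) * ∑ p ∈ antidiagonal n, G p.1 * G p.2 := by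
  have hsum : ∑ j ∈ Finset.Icc 1 (n + 1), G (n + 1 - j) * G (j - 1) =
      ∑ p ∈ antidiagonal n, G p.1 * G p.2 := by
    rw [Finset.Nat.sum_antidiagonal_eq_sum_range_succ_mk, ← Finset.Ico_add_one_right_eq_Icc,
      Finset.sum_Ico_eq_sum_range]
    refine Finset.sum_congr rfl fun i _ => ?_
    rw [mul_comm]
    congr 2 <;> omega
  have h : (n : ℝ) + 1 ≠ 0 := by positivity
  rw [hGrec (n + 1) (by omega), hsum, ← mul_assoc, ← mul_assoc, ← Polynomial.C_mul]
  push_cast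
  rw [mul_inv_cancel₀ h, Polynomial.C_1, one_mul]

lemma eval_one_generating (hG0 : G 0 = 1)
    (hG : ∀ n : ℕ, Polynomial.C ((n : ℝ) + 1) * G (n + 1) =
      Polynomial.X ^ (n + 2) * ∑ p ∈ antidiagonal n, G p.1 * G p.2) (n : ℕ) :
    (G n).eval 1 = 1 := by
  induction n using Nat.strong_induction_on with
  | _ n ih =>
    cases n with
    | zero => simp [hG0]
    | succ n =>
      have h := congrArg (Polynomial.eval 1) (hG n)
      have hsum : ∑ p ∈ antidiagonal n, (G p.1).eval 1 * (G p.2).eval 1 = (n : ℝ) + 1 := by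
        rw [Finset.sum_congr rfl (g := fun _ => (1 : ℝ)) fun p hp => by
          have := mem_antidiagonal.mp hp
          rw [ih p.1 (by omega), ih p.2 (by omega), one_mul]]
        simp
      simp only [Polynomial.eval_mul, Polynomial.eval_C, Polynomial.eval_pow, Polynomial.eval_X,
        one_pow, one_mul, Polynomial.eval_finsetSum, hsum] at h
      exact mul_left_cancel₀ (by positivity : (n : ℝ) + 1 ≠ 0) (h.trans (mul_one _).symm)

lemma eval_one_derivative_generating (hG0 : G 0 = 1)
    (hG : ∀ n : ℕ, Polynomial.C ((n : ℝ) + 1) * G (n + 1) =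
      Polynomial.X ^ (n + 2) * ∑ p ∈ antidiagonal n, G p.1 * G p.2) (n : ℕ) :
    (derivative (G n)).eval 1 = quicksortMean n := by
  refine eq_of_quicksort_recurrence (a := fun k => (derivative (G k)).eval 1)
    (r := fun k => ((k : ℝ) + 1) * (k + 2)) (fun m => ?_) ?_ ?_ (fun m => ?_) n
  · have h := congrArg (fun q => (derivative q).eval 1) (hG m)
    simp only [derivative_mul, derivative_C, zero_mul, zero_add, derivative_X_pow, derivative_sum,
      eval_add, eval_mul, eval_C, eval_pow, eval_X, one_pow, one_mul, mul_one, eval_finsetSum,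
      eval_one_generating hG0 hG, Finset.sum_add_distrib, Finset.sum_const,
      Finset.Nat.card_antidiagonal, nsmul_eq_mul,
      sum_antidiagonal_fst (fun k => (derivative (G k)).eval 1),
      sum_antidiagonal_snd (fun k => (derivative (G k)).eval 1)] at h
    push_cast at h
    linear_combination h
  · simp [hG0, quicksortMean_zero]
  · norm_num [quicksortMean, harmonicSum]
  · have h := quicksortMean_succ (m + 1)
    push_cast at h ⊢
    linear_combination h

lemma eval_one_derivative_derivative_generating (hG0 : G 0 = 1)
    (hG : ∀ n : ℕ, Polynomial.C ((n : ℝ) + 1) * G (n + 1) =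
      Polynomial.X ^ (n + 2) * ∑ p ∈ antidiagonal n, G p.1 * G p.2) (n : ℕ) :
    (derivative (derivative (G n))).eval 1 = quicksortSecondMoment n := by
  refine eq_of_quicksort_recurrence (a := fun k => (derivative (derivative (G k))).eval 1)
    (r := fun k => 2 * ((k : ℝ) + 2) * (k + 1) * quicksortMean (k + 1)
      - (k + 1) * (k + 2) * (k + 3) + 2 * meanConvolution k)
    (fun m => ?_) ?_ ?_ (fun m => ?_) n
  · have h := congrArg (fun q => (derivative (derivative q)).eval 1) (hG m)
    have hsum := sum_quicksortMean m
    simp only [derivative_mul, derivative_C, zero_mul, zero_add, derivative_X_pow, derivative_sum,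
      derivative_add, eval_add, eval_mul, eval_C, eval_pow, eval_X, one_pow, one_mul, mul_one,
      eval_finsetSum, eval_one_generating hG0 hG, eval_one_derivative_generating hG0 hG,
      Finset.sum_add_distrib, Finset.sum_const, Finset.Nat.card_antidiagonal, nsmul_eq_mul,
      sum_antidiagonal_fst quicksortMean, sum_antidiagonal_snd quicksortMean,
      sum_antidiagonal_fst (fun k => (derivative (derivative (G k))).eval 1),
      sum_antidiagonal_snd (fun k => (derivative (derivative (G k))).eval 1)] at h
    rw [← meanConvolution] at h
    push_cast at h
    linear_combination h + 2 * ((m : ℝ) + 2) * hsum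
  · simp [hG0, quicksortSecondMoment, quicksortMean_zero, harmonicSum_zero]
  · norm_num [quicksortSecondMoment, quicksortMean, meanConvolution, harmonicSum]
  · have h : (m : ℝ) + 1 + 1 ≠ 0 := by positivity
    simp only [quicksortSecondMoment, meanConvolution_eq, quicksortMean, harmonicSum_succ]
    push_cast
    field_simp
    ring

end GeneratingFunction

theorem quicksort_variance_closed_form
    (G : ℕ → Polynomial ℝ)
    (hG0 : G 0 = 1)
    (hGrec : ∀ n : ℕ, 1 ≤ n →
      G n = Polynomial.C ((n : ℝ))⁻¹ * Polynomial.X ^ (n + 1) *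
        ∑ j ∈ Finset.Icc 1 n, G (n - j) * G (j - 1)) :
    ∀ n : ℕ, 1 ≤ n →
      (Polynomial.derivative (Polynomial.derivative (G n))).eval 1
        - ((Polynomial.derivative (G n)).eval 1) ^ 2
        + (Polynomial.derivative (G n)).eval 1 =
      7 * n ^ 2 - 4 * (n + 1) ^ 2 * (∑ k ∈ Finset.Icc 1 n, (1 : ℝ) / (k : ℝ) ^ 2)
        - 2 * (n + 1) * (∑ k ∈ Finset.Icc 1 n, (1 : ℝ) / k) + 13 * n := by
  intro n _
  have hG := generating_succ hGrec
  rw [eval_one_derivative_generating hG0 hG, eval_one_derivative_derivative_generating hG0 hG]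
  simp only [quicksortSecondMoment, harmonicSum, pow_one]
  ring
end

section
/- For every real u with |u| < 1, Σ_{n≥0} β_2(n) u^n = 8 log^2(1−u)/(1−u)^3 − 8 log(1−u)/(1−u)^3 − 4 log^2(1−u)/(1−u)^2 + 12 log(1−u)/(1−u)^2 + 6/(1−u)^3 − 6/(1−u)^2, where β_2(n) = 4(n+1)^2 (H_n^2 − H_n^{(2)}) + 4(n+1)^2 H_n − 8(n+1) H_n + 8 n H_n − 4 n H_n (5 + 3n) + 11 n^2 + 15 n, with H_n = Σ_{k=1}^{n} 1/k and H_n^{(2)} = Σ_{k=1}^{n} 1/k^2. -/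
open Finset

/-- Dividing a power series by `1 - u` replaces its coefficients by their partial sums. -/
theorem hasSum_partialSum_mul_pow {u : ℝ} (hu : |u| < 1) {a b : ℕ → ℝ} {A : ℝ}
    (ha : HasSum (fun n => a n * u ^ n) A) (h0 : b 0 = a 0)
    (hsucc : ∀ n, b (n + 1) = b n + a (n + 1)) :
    HasSum (fun n => b n * u ^ n) (A / (1 - u)) := by
  have hg : HasSum (fun n => u ^ n) (1 - u)⁻¹ := hasSum_geometric_of_abs_lt_one hu
  have hb : ∀ n, b n = ∑ k ∈ range (n + 1), a k := by
    intro n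
    induction n with
    | zero => simp [h0]
    | succ n ih => rw [hsucc, sum_range_succ, ih]
  have hs := (summable_norm_sum_mul_antidiagonal_of_summable_norm
    ha.summable.norm hg.summable.norm).of_norm.hasSum
  rw [← tsum_mul_tsum_eq_tsum_sum_antidiagonal_of_summable_norm
    ha.summable.norm hg.summable.norm, ha.tsum_eq, hg.tsum_eq, ← div_eq_mul_inv] at hs
  refine hs.congr_fun fun n => ?_
  rw [hb, Nat.sum_antidiagonal_eq_sum_range_succ (fun i j => a i * u ^ i * u ^ j), sum_mul]
  refine sum_congr rfl fun k hk => ?_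
  rw [mul_assoc, ← pow_add, Nat.add_sub_cancel' (Nat.lt_succ_iff.mp (mem_range.mp hk))]

theorem hasSum_inv_mul_pow_neg_log {u : ℝ} (hu : |u| < 1) :
    HasSum (fun n : ℕ => (1 / (n : ℝ)) * u ^ n) (-Real.log (1 - u)) := by
  rw [← hasSum_nat_add_iff' 1]
  simpa [div_eq_inv_mul] using Real.hasSum_pow_div_log_of_abs_lt_one hu

theorem sum_antidiagonal_inv_mul_inv (n : ℕ) :
    ∑ p ∈ antidiagonal n, (1 / (p.1 : ℝ)) * (1 / (p.2 : ℝ))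
      = 2 * (∑ k ∈ Icc 1 n, (1 : ℝ) / k - 1 / n) / n := by
  rcases n.eq_zero_or_pos with rfl | hn
  · simp
  have hn' : (n : ℝ) ≠ 0 := by positivity
  have hH : ∑ k ∈ Icc 1 n, (1 : ℝ) / k = ∑ k ∈ range (n + 1), (1 : ℝ) / k := by
    rw [range_eq_Ico, sum_eq_sum_Ico_succ_bot (by omega : 0 < n + 1)]
    simp [Ico_add_one_right_eq_Icc]
  have hleft : ∑ p ∈ antidiagonal n, (1 : ℝ) / p.1 = ∑ k ∈ Icc 1 n, (1 : ℝ) / k := by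
    rw [Nat.sum_antidiagonal_eq_sum_range_succ (fun i _ => (1 : ℝ) / i), hH]
  have hright : ∑ p ∈ antidiagonal n, (1 : ℝ) / p.2 = ∑ k ∈ Icc 1 n, (1 : ℝ) / k := by
    rw [← hleft, ← Nat.sum_antidiagonal_swap]
    simp
  have hends : ∑ p ∈ antidiagonal n,
      ((if p = (0, n) then 1 / (n : ℝ) else 0) + if p = (n, 0) then 1 / (n : ℝ) else 0)
        = 2 / n := by
    rw [sum_add_distrib, sum_ite_eq', sum_ite_eq']
    simp
    ring
  have hterm : ∀ p ∈ antidiagonal n, (1 / (p.1 : ℝ)) * (1 / (p.2 : ℝ))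
      = (1 / p.1 + 1 / p.2 -
        ((if p = (0, n) then 1 / (n : ℝ) else 0) + if p = (n, 0) then 1 / (n : ℝ) else 0)) / n := by
    rintro ⟨i, j⟩ hp
    obtain rfl : i + j = n := by simpa using hp
    rcases i.eq_zero_or_pos with rfl | hi
    · have : j ≠ 0 := by omega
      simp [this]
    rcases j.eq_zero_or_pos with rfl | hj
    · have : i ≠ 0 := by omega
      simp [this]
    have hi' : (i : ℝ) ≠ 0 := by positivity
    have hj' : (j : ℝ) ≠ 0 := by positivity
    have hij : (i : ℝ) + j ≠ 0 := by positivity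
    simp only [Prod.mk.injEq, hi.ne', hj.ne', false_and, and_false, if_false, Nat.cast_add]
    field_simp
    ring
  rw [sum_congr rfl hterm, ← sum_div, sum_sub_distrib, sum_add_distrib, hleft, hright, hends]
  ring

theorem hasSum_mul_pow_log_sq {u : ℝ} (hu : |u| < 1) :
    HasSum (fun n : ℕ => 2 * (∑ k ∈ Icc 1 n, (1 : ℝ) / k - 1 / n) / n * u ^ n)
      (Real.log (1 - u) ^ 2) := by
  have hl := hasSum_inv_mul_pow_neg_log hu
  have hs := (summable_norm_sum_mul_antidiagonal_of_summable_norm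
    hl.summable.norm hl.summable.norm).of_norm.hasSum
  rw [← tsum_mul_tsum_eq_tsum_sum_antidiagonal_of_summable_norm
    hl.summable.norm hl.summable.norm, hl.tsum_eq, neg_mul_neg, ← sq] at hs
  refine hs.congr_fun fun n => ?_
  rw [← sum_antidiagonal_inv_mul_inv, sum_mul]
  refine sum_congr rfl fun p hp => ?_
  rw [← mem_antidiagonal.mp hp, pow_add]
  ring

theorem quicksort_second_moment_generating_function (u : ℝ) (hu : |u| < 1) :
    HasSum (fun n : ℕ =>
        (4 * ((n : ℝ) + 1) ^ 2 * ((∑ k ∈ Finset.Icc 1 n, (1 : ℝ) / k) ^ 2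
            - (∑ k ∈ Finset.Icc 1 n, (1 : ℝ) / (k : ℝ) ^ 2))
          + 4 * ((n : ℝ) + 1) ^ 2 * (∑ k ∈ Finset.Icc 1 n, (1 : ℝ) / k)
          - 8 * ((n : ℝ) + 1) * (∑ k ∈ Finset.Icc 1 n, (1 : ℝ) / k)
          + 8 * (n : ℝ) * (∑ k ∈ Finset.Icc 1 n, (1 : ℝ) / k)
          - 4 * (n : ℝ) * (∑ k ∈ Finset.Icc 1 n, (1 : ℝ) / k) * (5 + 3 * (n : ℝ))
          + 11 * (n : ℝ) ^ 2 + 15 * (n : ℝ)) * u ^ n)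
      (8 * (Real.log (1 - u)) ^ 2 / (1 - u) ^ 3
        - 8 * Real.log (1 - u) / (1 - u) ^ 3
        - 4 * (Real.log (1 - u)) ^ 2 / (1 - u) ^ 2
        + 12 * Real.log (1 - u) / (1 - u) ^ 2
        + 6 / (1 - u) ^ 3 - 6 / (1 - u) ^ 2) := by
  set H : ℕ → ℝ := fun n => ∑ k ∈ Icc 1 n, (1 : ℝ) / k with hH
  set Q : ℕ → ℝ := fun n => ∑ k ∈ Icc 1 n, (1 : ℝ) / (k : ℝ) ^ 2 with hQ
  have hH0 : H 0 = 0 := by simp [hH]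
  have hQ0 : Q 0 = 0 := by simp [hQ]
  have hHs : ∀ n, H (n + 1) = H n + 1 / ((n : ℝ) + 1) := fun n => by
    simp [hH, sum_Icc_succ_top]
  have hQs : ∀ n, Q (n + 1) = Q n + 1 / ((n : ℝ) + 1) ^ 2 := fun n => by
    simp [hQ, sum_Icc_succ_top]
  have hpos : ∀ n : ℕ, (n : ℝ) + 1 ≠ 0 := fun n => by positivity
  have hu1 : 1 - u ≠ 0 := by linarith [(abs_lt.mp hu).2]
  have c1 : HasSum (fun n : ℕ => 1 * u ^ n) (1 - u)⁻¹ := by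
    simpa using hasSum_geometric_of_abs_lt_one hu
  have c2 := hasSum_partialSum_mul_pow hu (b := fun n : ℕ => (n : ℝ) + 1) c1 (by simp)
    (fun n => by push_cast; ring)
  have c3 := hasSum_partialSum_mul_pow hu
    (b := fun n : ℕ => ((n : ℝ) + 1) * (n + 2) / 2) c2 (by simp) (fun n => by push_cast; ring)
  have l1 := hasSum_partialSum_mul_pow hu (b := H) (hasSum_inv_mul_pow_neg_log hu) (by simp [hH0])
    (fun n => by rw [hHs]; push_cast; ring)
  have l2 := hasSum_partialSum_mul_pow hu (b := fun n : ℕ => ((n : ℝ) + 1) * H n - n) l1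
    (by simp) (fun n => by have := hpos n; simp only [hHs]; push_cast; field_simp; ring)
  have l3 := hasSum_partialSum_mul_pow hu
    (b := fun n : ℕ => ((n : ℝ) + 1) * (n + 2) / 2 * (H n - 3 / 2) + (2 * n + 3) / 2) l2
    (by simp [hH0]) (fun n => by have := hpos n; simp only [hHs]; push_cast; field_simp; ring)
  have s1 := hasSum_partialSum_mul_pow hu (b := fun n : ℕ => H n ^ 2 - Q n)
    (hasSum_mul_pow_log_sq hu) (by simp [hH0, hQ0])
    (fun n => by
      have := hpos n
      change _ = _ + 2 * (H (n + 1) - 1 / ((n + 1 : ℕ) : ℝ)) / ((n + 1 : ℕ) : ℝ)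
      simp only [hHs, hQs]; push_cast; field_simp; ring)
  have s2 := hasSum_partialSum_mul_pow hu
    (b := fun n : ℕ => ((n : ℝ) + 1) * (H n ^ 2 - Q n) - 2 * n * H n + 2 * n) s1
    (by simp) (fun n => by have := hpos n; simp only [hHs, hQs]; push_cast; field_simp; ring)
  have s3 := hasSum_partialSum_mul_pow hu
    (b := fun n : ℕ => ((n : ℝ) + 1) * (n + 2) / 2 * (H n ^ 2 - Q n - 3 * H n + 7 / 2)
      + (2 * n + 3) * H n - 3 / 2 * (2 * n + 3) + 1) s2
    (by simp [hH0, hQ0]; norm_num)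
    (fun n => by have := hpos n; simp only [hHs, hQs]; push_cast; field_simp; ring)
  convert (((((s3.mul_left 8).add (l3.mul_left 8)).sub (s2.mul_left 4)).sub
    (l2.mul_left 12)).add (c3.mul_left 6)).sub (c2.mul_left 6) using 1
  · rfl
  · funext n
    simp only [hH, hQ]
    ring
  · field_simp
    ring
end

section
/- For every natural number m ≥ 0 and every real u with |u| < 1, 1/(1−u)^{m+1} · log(1/(1−u)) = Σ_{n≥0} (H_{n+m} − H_m) · binom(n+m, n) · u^n, where H_k = Σ_{j=1}^{k} 1/j denotes the k-th harmonic number. -/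
/-- Multiplying a convergent power series by the geometric series replaces its coefficients by
their partial sums. -/
theorem hasSum_partialSums_mul_pow {a : ℕ → ℝ} {u s : ℝ} (hu : |u| < 1)
    (h : HasSum (fun n => a n * u ^ n) s) :
    HasSum (fun n => (∑ k ∈ Finset.range (n + 1), a k) * u ^ n) (1 / (1 - u) * s) := by
  have hg := hasSum_geometric_of_abs_lt_one hu
  have hf := h.summable.norm
  have hg' := hg.summable.norm
  have hsum := (summable_norm_sum_mul_antidiagonal_of_summable_norm hf hg').of_norm.hasSum
  rw [← tsum_mul_tsum_eq_tsum_sum_antidiagonal_of_summable_norm hf hg', h.tsum_eq, hg.tsum_eq,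
    mul_comm, ← one_div] at hsum
  refine hsum.congr_fun fun n => ?_
  rw [Finset.Nat.sum_antidiagonal_eq_sum_range_succ (fun i j => a i * u ^ i * u ^ j),
    Finset.sum_mul]
  refine Finset.sum_congr rfl fun k hk => ?_
  rw [mul_assoc, ← pow_add, Nat.add_sub_of_le (Finset.mem_range_succ_iff.mp hk)]

theorem sum_range_harmonic_sub_mul_choose (m n : ℕ) :
    ∑ k ∈ Finset.range (n + 1),
        ((∑ j ∈ Finset.Icc 1 (k + m), (1 : ℝ) / j) - ∑ j ∈ Finset.Icc 1 m, (1 : ℝ) / j)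
          * ((k + m).choose k : ℝ)
      = ((∑ j ∈ Finset.Icc 1 (n + (m + 1)), (1 : ℝ) / j)
          - ∑ j ∈ Finset.Icc 1 (m + 1), (1 : ℝ) / j) * ((n + (m + 1)).choose n : ℝ) := by
  induction n with
  | zero => simp
  | succ n ih =>
    have hpascal : ((n + m + 2).choose (n + 1) : ℝ)
        = (n + m + 1).choose n + (n + m + 1).choose (n + 1) := by
      exact_mod_cast Nat.choose_succ_succ (n + m + 1) n
    have habsorb : ((n + m + 2).choose (n + 1) : ℝ) / (n + m + 2)
        = (n + m + 1).choose (n + 1) / (m + 1) := by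
      have h := Nat.choose_mul_succ_eq (n + m + 1) (n + 1)
      rw [show n + m + 1 + 1 - (n + 1) = m + 1 by omega] at h
      rw [div_eq_div_iff (by positivity) (by positivity)]
      have h' : ((n + m + 1).choose (n + 1) : ℝ) * (n + m + 1 + 1)
          = (n + m + 2).choose (n + 1) * (m + 1) := by exact_mod_cast h
      linear_combination -h'
    rw [Finset.sum_range_succ, ih, show n + 1 + (m + 1) = n + m + 1 + 1 by ring,
      show n + 1 + m = n + m + 1 by ring, show n + (m + 1) = n + m + 1 by ring,
      Finset.sum_Icc_succ_top (by omega : 1 ≤ n + m + 1 + 1),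
      Finset.sum_Icc_succ_top (by omega : 1 ≤ m + 1)]
    push_cast
    rw [show (n : ℝ) + m + 1 + 1 = n + m + 2 by ring]
    linear_combination -habsorb - ((∑ j ∈ Finset.Icc 1 (n + m + 1), (1 : ℝ) / j)
      - (∑ j ∈ Finset.Icc 1 m, (1 : ℝ) / j) - 1 / (m + 1)) * hpascal

theorem hasSum_one_div_mul_pow {u : ℝ} (hu : |u| < 1) :
    HasSum (fun n : ℕ => 1 / (n : ℝ) * u ^ n) (Real.log (1 / (1 - u))) := by
  rw [← hasSum_nat_add_iff' 1]
  simpa [div_eq_inv_mul] using Real.hasSum_pow_div_log_of_abs_lt_one hu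

open Finset

theorem greene_knuth_log_expansion (m : ℕ) (u : ℝ) (hu : |u| < 1) :
    HasSum (fun n : ℕ =>
        ((∑ j ∈ Finset.Icc 1 (n + m), (1 : ℝ) / j) - (∑ j ∈ Finset.Icc 1 m, (1 : ℝ) / j))
          * ((n + m).choose n : ℝ) * u ^ n)
      (1 / (1 - u) ^ (m + 1) * Real.log (1 / (1 - u))) := by
  induction m with
  | zero =>
    have h := hasSum_partialSums_mul_pow hu (hasSum_one_div_mul_pow hu)
    rw [zero_add, pow_one]
    refine h.congr_fun fun n => ?_
    simp [Finset.sum_range_eq_add_Ico _ n.succ_pos, Finset.Ico_add_one_right_eq_Icc]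
  | succ m ih =>
    have h := hasSum_partialSums_mul_pow hu ih
    simp only [sum_range_harmonic_sub_mul_choose] at h
    rwa [← mul_assoc, one_div_mul_one_div, ← pow_succ'] at h
end

section
/- For every natural number m ≥ 0 and every real u with |u| < 1, 1/(1−u)^{m+1} · log^2(1/(1−u)) = Σ_{n≥0} ((H_{n+m} − H_m)^2 − (H_{n+m}^{(2)} − H_m^{(2)})) · binom(n+m, n) · u^n, where H_k = Σ_{j=1}^{k} 1/j and H_k^{(2)} = Σ_{j=1}^{k} 1/j^2. -/
open Finset

/-- Dividing a power series by `1 - u` replaces its coefficients by their partial sums. -/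
theorem hasSum_partialSums_of_hasSum {a b : ℕ → ℝ} {A u : ℝ} (hu : |u| < 1)
    (h0 : b 0 = a 0) (hb : ∀ n, b (n + 1) = b n + a (n + 1))
    (ha : HasSum (fun n => a n * u ^ n) A) :
    HasSum (fun n => b n * u ^ n) (A * (1 - u)⁻¹) := by
  have hg : HasSum (fun n => u ^ n) (1 - u)⁻¹ := hasSum_geometric_of_abs_lt_one hu
  have hbs : ∀ n, b n = ∑ i ∈ range (n + 1), a i := by
    intro n
    induction n with
    | zero => simp [h0]
    | succ n ih => rw [hb, ih, sum_range_succ _ (n + 1)]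
  have key := (summable_norm_sum_mul_antidiagonal_of_summable_norm
    ha.summable.norm hg.summable.norm).of_norm.hasSum
  rw [← tsum_mul_tsum_eq_tsum_sum_antidiagonal_of_summable_norm
    ha.summable.norm hg.summable.norm, ha.tsum_eq, hg.tsum_eq] at key
  refine key.congr_fun fun n => ?_
  rw [hbs, Nat.sum_antidiagonal_eq_sum_range_succ_mk, sum_mul]
  refine sum_congr rfl fun i hi => ?_
  rw [mul_assoc, ← pow_add, Nat.add_sub_cancel' (Nat.lt_succ_iff.mp (mem_range.mp hi))]

theorem sum_antidiagonal_one_div_mul_one_div (n : ℕ) :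
    ∑ p ∈ antidiagonal n, 1 / ((p.1 : ℝ) + 1) * (1 / ((p.2 : ℝ) + 1))
      = 2 * (∑ j ∈ Icc 1 (n + 1), (1 : ℝ) / j) / (n + 2) := by
  have hH : ∑ p ∈ antidiagonal n, 1 / ((p.1 : ℝ) + 1) = ∑ j ∈ Icc 1 (n + 1), (1 : ℝ) / j := by
    rw [Nat.sum_antidiagonal_eq_sum_range_succ_mk]
    induction n with
    | zero => simp
    | succ n ih => rw [sum_range_succ, ih, sum_Icc_succ_top (by omega : 1 ≤ n + 1 + 1)]; simp
  have hH' : ∑ p ∈ antidiagonal n, 1 / ((p.2 : ℝ) + 1) = ∑ j ∈ Icc 1 (n + 1), (1 : ℝ) / j := by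
    rw [← hH, ← Nat.sum_antidiagonal_swap]
    simp
  rw [two_mul, add_div]
  nth_rewrite 1 [← hH]
  rw [← hH', sum_div, sum_div, ← sum_add_distrib]
  refine sum_congr rfl fun p hp => ?_
  have h : (n : ℝ) = p.1 + p.2 := by exact_mod_cast (mem_antidiagonal.mp hp).symm
  rw [h]
  have : (p.1 : ℝ) + p.2 + 2 ≠ 0 := by positivity
  field_simp
  ring

theorem hasSum_log_one_sub_sq {u : ℝ} (hu : |u| < 1) :
    HasSum (fun n : ℕ => 2 * (∑ j ∈ Icc 1 (n - 1), (1 : ℝ) / j) / n * u ^ n)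
      (Real.log (1 - u) ^ 2) := by
  have hL := Real.hasSum_pow_div_log_of_abs_lt_one hu
  have key := (summable_norm_sum_mul_antidiagonal_of_summable_norm
    hL.summable.norm hL.summable.norm).of_norm.hasSum
  rw [← tsum_mul_tsum_eq_tsum_sum_antidiagonal_of_summable_norm
    hL.summable.norm hL.summable.norm, hL.tsum_eq, neg_mul_neg, ← sq] at key
  rw [← hasSum_nat_add_iff' 2]
  simp only [sum_range_succ, range_zero, sum_empty]
  norm_num
  refine key.congr_fun fun n => ?_
  have hs := sum_antidiagonal_one_div_mul_one_div n
  norm_num at hs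
  rw [← hs, sum_mul]
  refine sum_congr rfl fun p hp => ?_
  rw [← mem_antidiagonal.mp hp]
  have h1 : (p.1 : ℝ) + 1 ≠ 0 := by positivity
  have h2 : (p.2 : ℝ) + 1 ≠ 0 := by positivity
  field_simp
  ring

theorem greene_knuth_log_sq_expansion (m : ℕ) (u : ℝ) (hu : |u| < 1) :
    HasSum (fun n : ℕ =>
        (((∑ j ∈ Finset.Icc 1 (n + m), (1 : ℝ) / j) - (∑ j ∈ Finset.Icc 1 m, (1 : ℝ) / j)) ^ 2
          - ((∑ j ∈ Finset.Icc 1 (n + m), (1 : ℝ) / (j : ℝ) ^ 2)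
              - (∑ j ∈ Finset.Icc 1 m, (1 : ℝ) / (j : ℝ) ^ 2)))
          * ((n + m).choose n : ℝ) * u ^ n)
      (1 / (1 - u) ^ (m + 1) * (Real.log (1 / (1 - u))) ^ 2) := by
  have hlog : Real.log (1 / (1 - u)) ^ 2 = Real.log (1 - u) ^ 2 := by
    rw [one_div, Real.log_inv, neg_sq]
  rw [hlog]
  induction m with
  | zero =>
    convert hasSum_partialSums_of_hasSum hu ?_ ?_ (hasSum_log_one_sub_sq hu) using 1
    · simp [mul_comm]
    · simp
    · intro n
      have h : (n : ℝ) + 1 ≠ 0 := by positivity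
      simp only [add_zero, sum_Icc_succ_top (Nat.le_add_left 1 n), Nat.choose_self,
        Nat.add_sub_cancel]
      push_cast
      field_simp
      simp
      ring
  | succ m ih =>
    convert hasSum_partialSums_of_hasSum hu ?_ ?_ ih using 1
    · rw [pow_succ _ (m + 1), one_div, one_div, mul_inv]
      ring
    · simp
    · intro n
      have hn : (n : ℝ) + 1 ≠ 0 := by positivity
      have hm : (m : ℝ) + 1 ≠ 0 := by positivity
      have hnm : (n : ℝ) + m + 2 ≠ 0 := by positivity
      have hc : ((n + 1 + m).choose (n + 1) : ℝ) * (n + 1)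
          = ((n + (m + 1)).choose n : ℝ) * (m + 1) := by
        have := Nat.choose_succ_right_eq (n + (m + 1)) n
        rw [Nat.add_sub_cancel_left] at this
        rw [show n + 1 + m = n + (m + 1) by ring]
        exact_mod_cast this
      have hc' : ((n + 1 + (m + 1)).choose (n + 1) : ℝ)
          = (n + (m + 1)).choose n + (n + 1 + m).choose (n + 1) := by
        rw [show n + 1 + (m + 1) = n + (m + 1) + 1 by ring, Nat.choose_succ_succ,
          show n + 1 + m = n + (m + 1) by ring]
        push_cast
        rfl
      rw [hc', eq_div_of_mul_eq hn hc, show n + 1 + (m + 1) = n + m + 1 + 1 by ring,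
        show n + 1 + m = n + m + 1 by ring, show n + (m + 1) = n + m + 1 by ring]
      rw [sum_Icc_succ_top (by omega : 1 ≤ n + m + 1 + 1),
        sum_Icc_succ_top (by omega : 1 ≤ n + m + 1 + 1),
        sum_Icc_succ_top (by omega : 1 ≤ m + 1), sum_Icc_succ_top (by omega : 1 ≤ m + 1)]
      generalize ∑ j ∈ Icc 1 (n + m + 1), (1 : ℝ) / j = P
      generalize ∑ j ∈ Icc 1 (n + m + 1), (1 : ℝ) / (j : ℝ) ^ 2 = Q
      generalize ∑ j ∈ Icc 1 m, (1 : ℝ) / j = R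
      generalize ∑ j ∈ Icc 1 m, (1 : ℝ) / (j : ℝ) ^ 2 = S
      generalize ((n + m + 1).choose n : ℝ) = C
      push_cast
      rw [show (n : ℝ) + m + 1 + 1 = n + m + 2 by ring]
      field_simp
      ring
end
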